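/- For every finite point set P ⊂ ℝ^d and every ε ∈ (0,1], there exists a finite multiset A ⊂ ℝ^d whose size is bounded by a function g(ε, d) of ε and d only (independent of |P|), such that for every convex set C ⊆ ℝ^d, |C ∩ P|/|P| − |C ∩ A|/|A| ≤ ε. -/

import Mathlib

open Finset in
theorem os_centerpoint {V : Type} [NormedAddCommGroup V] [NormedSpace ℝ V] [FiniteDimensional ℝ V]
    {ι : Type} (p : ι → V) (X : Finset ι) :
    ∃ a : V, ∀ f : V →ₗ[ℝ] ℝ,
      X.card ≤ (Module.finrank ℝ V + 1) * (X.filter (fun i => f a ≤ f (p i))).card := by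
  classical
  set d := Module.finrank ℝ V with hd
  by_cases hX : X.card = 0
  · exact ⟨0, fun f => by omega⟩
  let F : Finset ι → Set V := fun S => convexHull ℝ (p '' (S : Set ι))
  let 𝒮 : Finset (Finset ι) := X.powerset.filter (fun S => (d + 1) * (X \ S).card < X.card)
  have key : (⋂ S ∈ 𝒮, F S).Nonempty := by
    apply Convex.helly_theorem' (𝕜 := ℝ)
    · intro S _; exact convex_convexHull ℝ _
    · intro I hI hcard
      have h1 : (I.biUnion (fun S => X \ S)).card * (d + 1) < X.card * (d + 1) := by
        rcases I.eq_empty_or_nonempty with h | h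
        · subst h; simp only [biUnion_empty, card_empty, zero_mul]; positivity
        calc (I.biUnion (fun S => X \ S)).card * (d + 1)
            ≤ (∑ S ∈ I, (X \ S).card) * (d + 1) := Nat.mul_le_mul_right _ card_biUnion_le
          _ = ∑ S ∈ I, (d + 1) * (X \ S).card := by rw [← Finset.mul_sum, mul_comm]
          _ < ∑ S ∈ I, X.card := by
              apply Finset.sum_lt_sum_of_nonempty h
              intro S hS
              exact (Finset.mem_filter.1 (hI hS)).2
          _ = I.card * X.card := by simp
          _ ≤ X.card * (d + 1) := by rw [mul_comm]; exact Nat.mul_le_mul_left _ hcard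
      have h2 : (I.biUnion (fun S => X \ S)).card < X.card := lt_of_mul_lt_mul_right h1 (Nat.zero_le _)
      obtain ⟨x, hx, hx'⟩ := Finset.exists_mem_notMem_of_card_lt_card h2
      refine ⟨p x, ?_⟩
      simp only [Set.mem_iInter]
      intro S hS
      apply subset_convexHull
      refine ⟨x, ?_, rfl⟩
      by_contra hc
      exact hx' (Finset.mem_biUnion.2 ⟨S, hS, Finset.mem_sdiff.2 ⟨hx, by simpa using hc⟩⟩)
  obtain ⟨a, ha⟩ := key
  refine ⟨a, fun f => ?_⟩
  by_contra hc
  push Not at hc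
  have hS : X.filter (fun i => ¬ f a ≤ f (p i)) ∈ 𝒮 := by
    refine Finset.mem_filter.2 ⟨by simp, ?_⟩
    have he : X \ X.filter (fun i => ¬ f a ≤ f (p i)) = X.filter (fun i => f a ≤ f (p i)) := by
      ext i; simp only [mem_sdiff, mem_filter]; tauto
    rw [he]; exact hc
  simp only [Set.mem_iInter] at ha
  have h3 := ha _ hS
  have h4 : F (X.filter (fun i => ¬ f a ≤ f (p i))) ⊆ {x | f x < f a} := by
    apply convexHull_min
    · rintro _ ⟨i, hi, rfl⟩
      simpa using (Finset.mem_filter.1 hi).2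
    · exact convex_halfSpace_lt f.isLinear _
  have h5 : f a < f a := h4 h3
  exact lt_irrefl _ h5

/-- weak ham sandwich -/
theorem os_ham {V : Type} [NormedAddCommGroup V] [NormedSpace ℝ V] [FiniteDimensional ℝ V]
    {ι : Type} (p : ι → V) {N : ℕ} (X : Fin N → Finset ι) (hd : 1 ≤ Module.finrank ℝ V)
    (I J : Finset (Fin N)) (hIJ : Disjoint I J) (hc : (I ∪ J).card = Module.finrank ℝ V + 1) :
    ∃ (f : V →ₗ[ℝ] ℝ) (t : ℝ), f ≠ 0 ∧
      (∀ i ∈ I, (X i).card ≤ (Module.finrank ℝ V + 1) * ((X i).filter (fun x => t ≤ f (p x))).card) ∧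
      (∀ i ∈ J, (X i).card ≤ (Module.finrank ℝ V + 1) * ((X i).filter (fun x => f (p x) ≤ t)).card) := by
  classical
  choose c hcp using fun i => os_centerpoint p (X i)
  set d := Module.finrank ℝ V with hdd
  have hne : (I ∪ J).Nonempty := by rw [← Finset.card_pos]; omega
  obtain ⟨i0, hi0⟩ := hne
  let T := (I ∪ J).erase i0
  have hT : T.card = d := by rw [Finset.card_erase_of_mem hi0, hc]; rfl
  let Φ : (Module.Dual ℝ V × ℝ) →ₗ[ℝ] (T → ℝ) :=
    LinearMap.pi fun i => (Module.Dual.eval ℝ V (c i)).comp (LinearMap.fst ℝ _ _) - LinearMap.snd ℝ _ _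
  have hker : LinearMap.ker Φ ≠ ⊥ := by
    apply LinearMap.ker_ne_bot_of_finrank_lt
    simp [hT, Subspace.dual_finrank_eq]
    omega
  obtain ⟨⟨f, t⟩, hmem, hft⟩ := Submodule.exists_mem_ne_zero_of_ne_bot hker
  have hmem' : ∀ i ∈ T, f (c i) = t := by
    intro i hi
    have := congrFun (LinearMap.mem_ker.1 hmem) ⟨i, hi⟩
    simp [Φ] at this
    linarith
  have hf : f ≠ 0 := by
    rintro rfl
    obtain ⟨i, hi⟩ : T.Nonempty := by rw [← Finset.card_pos]; omega
    have := hmem' i hi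
    simp at this
    exact hft (by simp [← this])
  -- both sides big for T
  have hge : ∀ i ∈ T, (X i).card ≤ (d + 1) * ((X i).filter (fun x => t ≤ f (p x))).card := by
    intro i hi
    have := hcp i f
    rwa [hmem' i hi] at this
  have hle : ∀ i ∈ T, (X i).card ≤ (d + 1) * ((X i).filter (fun x => f (p x) ≤ t)).card := by
    intro i hi
    have := hcp i (-f)
    simpa [hmem' i hi] using this
  have hhalf : (X i0).card ≤ ((X i0).filter (fun x => t ≤ f (p x))).card
      + ((X i0).filter (fun x => f (p x) ≤ t)).card := by
    rw [← Finset.card_filter_add_card_filter_not (s := X i0) (fun x => t ≤ f (p x))]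
    gcongr with x hx
    intro h; push Not at h; exact h.le
  have hcase : (X i0).card ≤ (d + 1) * ((X i0).filter (fun x => t ≤ f (p x))).card ∨
      (X i0).card ≤ (d + 1) * ((X i0).filter (fun x => f (p x) ≤ t)).card := by
    by_contra hh
    push Not at hh
    nlinarith [hh.1, hh.2]
  have hTmem : ∀ i ∈ I ∪ J, i ≠ i0 → i ∈ T := fun i hi h => Finset.mem_erase.2 ⟨h, hi⟩
  -- final choice
  have fin1 : ∀ (g : V →ₗ[ℝ] ℝ) (u : ℝ), 
      (∀ i ∈ T, (X i).card ≤ (d + 1) * ((X i).filter (fun x => u ≤ g (p x))).card) →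
      (∀ i ∈ T, (X i).card ≤ (d + 1) * ((X i).filter (fun x => g (p x) ≤ u)).card) →
      (i0 ∈ I → (X i0).card ≤ (d + 1) * ((X i0).filter (fun x => u ≤ g (p x))).card) →
      (i0 ∈ J → (X i0).card ≤ (d + 1) * ((X i0).filter (fun x => g (p x) ≤ u)).card) →
      (∀ i ∈ I, (X i).card ≤ (d + 1) * ((X i).filter (fun x => u ≤ g (p x))).card) ∧
      (∀ i ∈ J, (X i).card ≤ (d + 1) * ((X i).filter (fun x => g (p x) ≤ u)).card) := by
    intro g u h1 h2 h3 h4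
    constructor
    · intro i hi
      by_cases h : i = i0
      · subst h; exact h3 hi
      · exact h1 i (hTmem i (Finset.mem_union_left _ hi) h)
    · intro i hi
      by_cases h : i = i0
      · subst h; exact h4 hi
      · exact h2 i (hTmem i (Finset.mem_union_right _ hi) h)
  have hdis : i0 ∈ I → i0 ∈ J → False := fun h1 h2 => Finset.disjoint_left.1 hIJ h1 h2
  by_cases hI : i0 ∈ I
  · rcases hcase with h | h
    · exact ⟨f, t, hf, fin1 f t hge hle (fun _ => h) (fun h' => (hdis hI h').elim)⟩
    · refine ⟨-f, -t, neg_ne_zero.2 hf, fin1 (-f) (-t) ?_ ?_ ?_ (fun h' => (hdis hI h').elim)⟩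
      · simpa using hle
      · simpa using hge
      · simpa using fun _ => h
  · rcases hcase with h | h
    · refine ⟨-f, -t, neg_ne_zero.2 hf, fin1 (-f) (-t) ?_ ?_ (fun h' => (hI h').elim) ?_⟩
      · simpa using hle
      · simpa using hge
      · simpa using fun _ => h
    · exact ⟨f, t, hf, fin1 f t hge hle (fun h' => (hI h').elim) (fun _ => h)⟩

theorem os_shrink {V : Type} [NormedAddCommGroup V] [NormedSpace ℝ V] [FiniteDimensional ℝ V]
    {ι : Type} (p : ι → V) {N : ℕ} (X : Fin N → Finset ι) (hd : 1 ≤ Module.finrank ℝ V)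
    (γ s β : ℝ) (hγ : γ = 1 / (2 * (Module.finrank ℝ V + 1))) (hs : ∀ i, s ≤ (X i).card)
    (hs0 : 0 ≤ s)
    (hβ : ∀ (f : V →ₗ[ℝ] ℝ) (t : ℝ), f ≠ 0 → ∀ i,
      (((X i).filter (fun x => f (p x) = t)).card : ℝ) ≤ β)
    (L : Finset (Finset (Fin N) × Finset (Fin N))) (hβL : β ≤ γ ^ L.card * s)
    (hL : ∀ q ∈ L, Disjoint q.1 q.2 ∧ (q.1 ∪ q.2).card = Module.finrank ℝ V + 1) :
    ∃ Y : Fin N → Finset ι, (∀ i, Y i ⊆ X i) ∧ (∀ i, γ ^ L.card * s ≤ (Y i).card) ∧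
      ∀ q ∈ L, ∃ (f : V →ₗ[ℝ] ℝ) (t : ℝ), (∀ i ∈ q.1, ∀ x ∈ Y i, t < f (p x)) ∧
        (∀ i ∈ q.2, ∀ x ∈ Y i, f (p x) < t) := by
  classical
  have hγ0 : 0 < γ := by rw [hγ]; positivity
  have hγ1 : γ ≤ 1 := by
    rw [hγ, div_le_one (by positivity)]
    have : (0:ℝ) ≤ Module.finrank ℝ V := by positivity
    linarith
  induction L using Finset.induction_on with
  | empty => exact ⟨X, fun i => subset_rfl, by simpa using hs, by simp⟩
  | insert q L hq ih =>
    rw [Finset.card_insert_of_notMem hq] at hβL ⊢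
    have hle : γ ^ (L.card + 1) * s ≤ γ ^ L.card * s := by
      apply mul_le_mul_of_nonneg_right _ hs0
      exact pow_le_pow_of_le_one hγ0.le hγ1 (Nat.le_succ _)
    obtain ⟨Y, hYX, hYc, hYs⟩ := ih (hβL.trans hle) (fun q hq => hL q (Finset.mem_insert_of_mem hq))
    obtain ⟨hdis, hcard⟩ := hL q (Finset.mem_insert_self _ _)
    obtain ⟨f, t, hf, h1, h2⟩ := os_ham p Y hd q.1 q.2 hdis hcard
    set d := Module.finrank ℝ V
    let Z : Fin N → Finset ι := fun i =>
      if i ∈ q.1 then (Y i).filter (fun x => t < f (p x)) else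
      if i ∈ q.2 then (Y i).filter (fun x => f (p x) < t) else Y i
    have hZY : ∀ i, Z i ⊆ Y i := by
      intro i
      simp only [Z]
      split_ifs
      · exact Finset.filter_subset _ _
      · exact Finset.filter_subset _ _
      · exact subset_rfl
    have hcal : ∀ (A B C : Finset ι) (i : Fin N), (Y i).card ≤ (d + 1) * A.card →
        A ⊆ B ∪ C → C ⊆ (X i).filter (fun x => f (p x) = t) → γ ^ (L.card + 1) * s ≤ B.card := by
      intro A B C i hA hABC hC
      have e1 : (A.card : ℝ) ≤ B.card + C.card := by
        exact_mod_cast (Finset.card_le_card hABC).trans (Finset.card_union_le _ _)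
      have e2 : (C.card : ℝ) ≤ β := 
        le_trans (by exact_mod_cast Finset.card_le_card hC) (hβ f t hf i)
      have e3 : ((Y i).card : ℝ) ≤ (d + 1) * A.card := by exact_mod_cast hA
      have e4 := hYc i
      have e5 : γ ^ (L.card + 1) * s = γ * (γ ^ L.card * s) := by ring
      have e6 : (1:ℝ) = γ * (2 * (d + 1)) := by rw [hγ]; field_simp
      have e7 : 2 * (γ ^ (L.card + 1) * s) ≤ A.card := by
        rw [e5]
        have : γ * (γ ^ L.card * s) ≤ γ * ((d + 1) * A.card) := 
          mul_le_mul_of_nonneg_left (e4.trans e3) hγ0.le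
        have e8 : γ * ((d + 1) * A.card) = (γ * (2 * (d + 1))) * A.card / 2 := by ring
        rw [e8, ← e6] at this
        linarith
      linarith
    refine ⟨Z, fun i => (hZY i).trans (hYX i), ?_, ?_⟩
    · intro i
      by_cases hi1 : i ∈ q.1
      · have hZ : Z i = (Y i).filter (fun x => t < f (p x)) := by simp [Z, hi1]
        rw [hZ]
        refine hcal _ _ ((Y i).filter (fun x => f (p x) = t)) i (h1 i hi1) ?_ 
          (Finset.filter_subset_filter _ (hYX i))
        intro x hx
        simp only [Finset.mem_union, Finset.mem_filter] at hx ⊢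
        rcases hx.2.lt_or_eq with h | h
        · exact Or.inl ⟨hx.1, h⟩
        · exact Or.inr ⟨hx.1, h.symm⟩
      · by_cases hi2 : i ∈ q.2
        · have hZ : Z i = (Y i).filter (fun x => f (p x) < t) := by simp [Z, hi1, hi2]
          rw [hZ]
          refine hcal _ _ ((Y i).filter (fun x => f (p x) = t)) i (h2 i hi2) ?_ 
            (Finset.filter_subset_filter _ (hYX i))
          intro x hx
          simp only [Finset.mem_union, Finset.mem_filter] at hx ⊢
          rcases hx.2.lt_or_eq with h | h
          · exact Or.inl ⟨hx.1, h⟩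
          · exact Or.inr ⟨hx.1, h⟩
        · have hZ : Z i = Y i := by simp [Z, hi1, hi2]
          rw [hZ]
          exact hle.trans (hYc i)
    · intro q' hq'
      rcases Finset.mem_insert.1 hq' with rfl | hq'
      · refine ⟨f, t, ?_, ?_⟩
        · intro i hi x hx
          have : x ∈ (Y i).filter (fun x => t < f (p x)) := by simpa [Z, hi] using hx
          exact (Finset.mem_filter.1 this).2
        · intro i hi x hx
          have hi' : i ∉ q'.1 := fun h => Finset.disjoint_left.1 hdis h hi
          have : x ∈ (Y i).filter (fun x => f (p x) < t) := by simpa [Z, hi, hi'] using hx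
          exact (Finset.mem_filter.1 this).2
      · obtain ⟨g, u, hg1, hg2⟩ := hYs q' hq'
        exact ⟨g, u, fun i hi x hx => hg1 i hi x (hZY i hx), fun i hi x hx => hg2 i hi x (hZY i hx)⟩

theorem os_cross {V : Type} [NormedAddCommGroup V] [NormedSpace ℝ V] [FiniteDimensional ℝ V]
    {ι : Type} (p : ι → V) {N : ℕ} (Y : Fin N → Finset ι)
    (hsep : ∀ I J : Finset (Fin N), Disjoint I J → (I ∪ J).card = Module.finrank ℝ V + 1 →
      ∃ (f : V →ₗ[ℝ] ℝ) (t : ℝ), (∀ i ∈ I, ∀ x ∈ Y i, t < f (p x)) ∧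
        (∀ i ∈ J, ∀ x ∈ Y i, f (p x) < t))
    (f : V →ₗ[ℝ] ℝ) (t : ℝ) (T : Finset (Fin N)) (hT : T.card = Module.finrank ℝ V + 1)
    (q y : Fin N → ι) (hq : ∀ i, q i ∈ Y i) (hy : ∀ i, y i ∈ Y i)
    (hqt : ∀ i ∈ T, f (p (q i)) < t) (hyt : ∀ i ∈ T, t ≤ f (p (y i))) : False := by
  classical
  have hx : ∀ i : T, ∃ x ∈ segment ℝ (p (q i)) (p (y i)), f x = t := by
    intro i
    have h1 := hqt i i.2
    have h2 := hyt i i.2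
    have : t ∈ f '' segment ℝ (p (q i)) (p (y i)) := by
      have h := image_segment ℝ f.toAffineMap (p (q i)) (p (y i))
      simp only [LinearMap.coe_toAffineMap] at h
      rw [h, segment_eq_Icc (h1.le.trans h2)]
      exact ⟨h1.le, h2⟩
    obtain ⟨x, hx, hx'⟩ := this
    exact ⟨x, hx, hx'⟩
  choose x hxs hxt using hx
  have hna : ¬ AffineIndependent ℝ x := by
    intro hai
    have htop := (hai.affineSpan_eq_top_iff_card_eq_finrank_add_one).2 (by simpa using hT)
    obtain ⟨i, hi⟩ : T.Nonempty := by rw [← Finset.card_pos]; omega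
    have hmem : p (q i) ∈ affineSpan ℝ (Set.range x) := by rw [htop]; trivial
    have hle : affineSpan ℝ (Set.range x) ≤ 
        (AffineSubspace.mk' t (⊥ : Submodule ℝ ℝ)).comap f.toAffineMap := by
      rw [affineSpan_le]
      rintro _ ⟨j, rfl⟩
      simp [hxt]
    have := hle hmem
    simp at this
    have h' := hqt i hi
    rw [sub_eq_zero] at this
    exact h'.ne this
  obtain ⟨I, z, hz1, hz2⟩ := Convex.radon_partition hna
  let I' : Finset (Fin N) := T.filter (fun i => ∃ h : i ∈ T, (⟨i, h⟩ : T) ∈ I)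
  let J' : Finset (Fin N) := T.filter (fun i => ¬ ∃ h : i ∈ T, (⟨i, h⟩ : T) ∈ I)
  obtain ⟨g, u, hg1, hg2⟩ := hsep I' J' (Finset.disjoint_filter_filter_not _ _ _)
    (by rw [Finset.filter_union_filter_not_eq]; exact hT)
  have c1 : convexHull ℝ (x '' I) ⊆ {v | u < g v} := by
    apply convexHull_min
    · rintro _ ⟨i, hi, rfl⟩
      have hi' : (i : Fin N) ∈ I' := Finset.mem_filter.2 ⟨i.2, i.2, hi⟩
      exact (convex_halfSpace_gt g.isLinear u).segment_subset (hg1 i hi' _ (hq i)) (hg1 i hi' _ (hy i)) (hxs i)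
    · exact convex_halfSpace_gt g.isLinear _
  have c2 : convexHull ℝ (x '' Iᶜ) ⊆ {v | g v < u} := by
    apply convexHull_min
    · rintro _ ⟨i, hi, rfl⟩
      have hi' : (i : Fin N) ∈ J' := Finset.mem_filter.2 ⟨i.2, fun ⟨_, h⟩ => hi h⟩
      exact (convex_halfSpace_lt g.isLinear u).segment_subset (hg2 i hi' _ (hq i)) (hg2 i hi' _ (hy i)) (hxs i)
    · exact convex_halfSpace_lt g.isLinear _
  have e1 : u < g z := c1 hz1
  have e2 : g z < u := c2 hz2
  exact lt_asymm e1 e2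

theorem os_split {ι : Type} [DecidableEq ι] (s : ℕ) : ∀ (N : ℕ) (X : Finset ι), N * s ≤ X.card →
    ∃ Y : Fin N → Finset ι, (∀ i, Y i ⊆ X) ∧ (∀ i j, i ≠ j → Disjoint (Y i) (Y j)) ∧
      ∀ i, (Y i).card = s := by
  intro N
  induction N with
  | zero => intro X _; exact ⟨fun _ => ∅, fun i => i.elim0, fun i => i.elim0, fun i => i.elim0⟩
  | succ N ih =>
    intro X hX
    have h1 : s ≤ X.card := by nlinarith
    obtain ⟨A, hA, hAs⟩ := Finset.exists_subset_card_eq h1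
    obtain ⟨Y, hY1, hY2, hY3⟩ := ih (X \ A) (by
      rw [Finset.card_sdiff_of_subset hA, hAs]
      have : (N + 1) * s = N * s + s := by ring
      omega)
    have hd : ∀ i, Disjoint A (Y i) := fun i =>
      Finset.disjoint_of_subset_right (hY1 i) Finset.disjoint_sdiff
    refine ⟨Fin.cons A Y, ?_, ?_, ?_⟩
    · intro i
      refine Fin.cases ?_ ?_ i
      · simpa using hA
      · intro j; simpa using (hY1 j).trans Finset.sdiff_subset
    · intro i j
      refine Fin.cases ?_ ?_ i <;> refine Fin.cases ?_ ?_ j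
      · simp
      · intro j _; simpa using hd j
      · intro i _; simpa using (hd i).symm
      · intro j i hij; simpa using hY2 i j (fun h => hij (by rw [h]))
    · intro i
      refine Fin.cases ?_ ?_ i
      · simpa using hAs
      · intro j; simpa using hY3 j

theorem os_node (ι : Type) (N : ℕ) : ∀ d : ℕ, (d + 1) ^ 2 ≤ N → ∃ c : ℝ, 0 < c ∧
    ∀ (V : Type) [NormedAddCommGroup V] [NormedSpace ℝ V] [FiniteDimensional ℝ V],
      Module.finrank ℝ V = d → ∀ (p : ι → V) (X : Finset ι) (s : ℕ), (s : ℝ) ≤ c * X.card →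
      ∃ Y : Fin N → Finset ι, (∀ i, Y i ⊆ X) ∧ (∀ i j, i ≠ j → Disjoint (Y i) (Y j)) ∧
        (∀ i, (Y i).card = s) ∧ ∃ a : V, ∀ q : Fin N → ι, (∀ i, q i ∈ Y i) →
          a ∈ convexHull ℝ (Set.range (fun i => p (q i))) := by
  classical
  intro d
  induction d with
  | zero =>
    intro hN
    have hN0 : 0 < N := by omega
    have hN0' : (0:ℝ) < N := by exact_mod_cast hN0
    refine ⟨1 / N, by positivity, ?_⟩
    intro V _ _ _ hV p X s hs
    have : N * s ≤ X.card := by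
      have h : (N : ℝ) * s ≤ X.card := by
        have := mul_le_mul_of_nonneg_left hs hN0'.le
        have e : (N : ℝ) * (1 / N * X.card) = X.card := by field_simp
        linarith
      exact_mod_cast h
    obtain ⟨Y, h1, h2, h3⟩ := os_split s N X this
    refine ⟨Y, h1, h2, h3, 0, fun q _ => ?_⟩
    have hsub : Subsingleton V := Module.finrank_zero_iff.1 hV
    rw [Subsingleton.elim (0 : V) (p (q ⟨0, hN0⟩))]
    exact subset_convexHull ℝ _ ⟨⟨0, hN0⟩, rfl⟩
  | succ d ih =>
    intro hN
    obtain ⟨c', hc', ih⟩ := ih (le_trans (Nat.pow_le_pow_left (by omega) 2) hN)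
    have hN0 : 0 < N := lt_of_lt_of_le (by positivity) hN
    have hN0' : (0:ℝ) < N := by exact_mod_cast hN0
    let L : Finset (Finset (Fin N) × Finset (Fin N)) :=
      Finset.univ.filter (fun q => Disjoint q.1 q.2 ∧ (q.1 ∪ q.2).card = d + 1 + 1)
    obtain ⟨γ, hγ⟩ : ∃ γ : ℝ, γ = 1 / (2 * (((d + 1 : ℕ) : ℝ) + 1)) := ⟨_, rfl⟩
    have hγ0 : 0 < γ := by rw [hγ]; positivity
    have hγ1 : γ ≤ 1 := by
      rw [hγ, div_le_one (by positivity)]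
      have : (0:ℝ) ≤ ((d + 1 : ℕ) : ℝ) := by positivity
      linarith
    obtain ⟨Γ, hΓ⟩ : ∃ Γ : ℝ, Γ = γ ^ L.card := ⟨_, rfl⟩
    have hΓ0 : 0 < Γ := by rw [hΓ]; positivity
    have hΓ1 : Γ ≤ 1 := by rw [hΓ]; exact pow_le_one₀ hγ0.le hγ1
    obtain ⟨κ, hκ⟩ : ∃ κ : ℝ, κ = Γ / (2 * N) := ⟨_, rfl⟩
    have hκ0 : 0 < κ := by rw [hκ]; positivity
    refine ⟨κ * min 1 c', by positivity, ?_⟩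
    intro V _ _ _ hV p X s hs
    rcases Nat.eq_zero_or_pos s with rfl | hs1
    · exact ⟨fun _ => ∅, by simp, by simp, by simp, 0, fun q hq => by simpa using hq ⟨0, hN0⟩⟩
    have hX0 : (0:ℝ) ≤ X.card := by positivity
    have hsκ : (s : ℝ) ≤ κ * X.card := hs.trans (by
      apply mul_le_mul_of_nonneg_right _ hX0
      exact mul_le_of_le_one_right hκ0.le (min_le_left _ _))
    have hsκ' : (s : ℝ) ≤ c' * (κ * X.card) := hs.trans (by
      have : κ * min 1 c' ≤ κ * c' := mul_le_mul_of_nonneg_left (min_le_right _ _) hκ0.le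
      have := mul_le_mul_of_nonneg_right this hX0
      linarith)
    by_cases hyp : ∃ (f : V →ₗ[ℝ] ℝ) (t : ℝ), f ≠ 0 ∧
        κ * X.card ≤ (X.filter (fun x => f (p x) = t)).card
    · obtain ⟨f, t, hf, hcard⟩ := hyp
      obtain ⟨x0, hx0⟩ := (LinearMap.surjective hf) t
      have hfr : Module.finrank ℝ (LinearMap.ker f) = d := by
        have := Module.Dual.finrank_ker_add_one_of_ne_zero hf
        omega
      let p' : ι → LinearMap.ker f := fun i =>
        if h : f (p i) = t then ⟨p i - x0, by simp [h, hx0]⟩ else 0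
      obtain ⟨Y, h1, h2, h3, a, ha⟩ := ih (LinearMap.ker f) hfr p'
        (X.filter (fun x => f (p x) = t)) s
        (hsκ'.trans (mul_le_mul_of_nonneg_left hcard hc'.le))
      refine ⟨Y, fun i => (h1 i).trans (Finset.filter_subset _ _), h2, h3, a + x0, ?_⟩
      intro q hq
      have hmem := ha q hq
      let g : LinearMap.ker f →ᵃ[ℝ] V := 
        (LinearMap.ker f).subtype.toAffineMap + AffineMap.const ℝ _ x0
      have hg : g a ∈ g '' convexHull ℝ (Set.range fun i => p' (q i)) := ⟨a, hmem, rfl⟩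
      rw [AffineMap.image_convexHull] at hg
      have e1 : g a = a + x0 := by simp [g]
      rw [e1] at hg
      convert hg using 2
      rw [← Set.range_comp]
      congr 1
      funext i
      have hi : f (p (q i)) = t := (Finset.mem_filter.1 (h1 i (hq i))).2
      simp [g, p', hi]
    · push Not at hyp
      obtain ⟨s0, hs0⟩ : ∃ s0 : ℕ, s0 = X.card / N := ⟨_, rfl⟩
      obtain ⟨X', hX1, hX2, hX3⟩ := os_split s0 N X (by rw [hs0]; exact Nat.mul_div_le _ _)
      have hs0' : (X.card : ℝ) ≤ 2 * N * s0 := by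
        have h1 : (X.card : ℝ) < N * (s0 + 1) := by
          rw [hs0]
          exact_mod_cast Nat.lt_mul_div_succ X.card hN0
        have h2 : (1:ℝ) ≤ κ * X.card := le_trans (by exact_mod_cast hs1) hsκ
        have h3 : 2 * N ≤ (X.card : ℝ) := by
          have h4 : κ * (2 * N) ≤ 1 := by
            rw [hκ, div_mul_cancel₀ _ (by positivity)]; exact hΓ1
          exact le_of_mul_le_mul_left (h4.trans h2) hκ0
        nlinarith
      have hκX : κ * X.card ≤ Γ * s0 := by
        have := mul_le_mul_of_nonneg_left hs0' hκ0.le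
        have e : κ * (2 * N * s0) = Γ * s0 := by rw [hκ]; field_simp
        linarith
      obtain ⟨Y, hY1, hY2, hY3⟩ := os_shrink p X' (by omega) γ s0 (κ * X.card)
        (by rw [hγ, hV]) (fun i => by rw [hX3]) (by positivity)
        (fun f t hf i => le_trans (by
          exact_mod_cast Finset.card_le_card (Finset.filter_subset_filter _ (hX1 i))) (hyp f t hf).le)
        L (by rw [← hΓ]; exact hκX) (fun q hq => by rw [hV]; exact (Finset.mem_filter.1 hq).2)
      have hYs : ∀ i, s ≤ (Y i).card := by
        intro i
        have := hY2 i
        rw [← hΓ] at this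
        exact_mod_cast hsκ.trans (hκX.trans this)
      choose Z hZ1 hZ2 using fun i => Finset.exists_subset_card_eq (hYs i)
      have hne : ∀ i, (Z i).Nonempty := fun i => by rw [← Finset.card_pos, hZ2]; exact hs1
      choose y hy using hne
      obtain ⟨a, ha⟩ := os_centerpoint (fun i => p (y i)) (Finset.univ : Finset (Fin N))
      refine ⟨Z, fun i => (hZ1 i).trans ((hY1 i).trans (hX1 i)), ?_, hZ2, a, ?_⟩
      · intro i j hij
        exact Finset.disjoint_of_subset_left ((hZ1 i).trans (hY1 i))
          (Finset.disjoint_of_subset_right ((hZ1 j).trans (hY1 j)) (hX2 i j hij))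
      · intro q hq
        by_contra hcon
        have hclosed : IsClosed (convexHull ℝ (Set.range (fun i => p (q i)))) :=
          (Set.finite_range _).isClosed_convexHull (𝕜 := ℝ)
        obtain ⟨f, u, hf1, hf2⟩ := geometric_hahn_banach_closed_point (convex_convexHull ℝ _)
          hclosed hcon
        have hc := ha (f : V →ₗ[ℝ] ℝ)
        rw [hV, Finset.card_univ, Fintype.card_fin] at hc
        have hc2 : d + 1 + 1 ≤ (Finset.univ.filter (fun i => 
            (f : V →ₗ[ℝ] ℝ) a ≤ (f : V →ₗ[ℝ] ℝ) (p (y i)))).card := by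
          by_contra h
          push Not at h
          nlinarith
        obtain ⟨T, hT1, hT2⟩ := Finset.exists_subset_card_eq hc2
        refine os_cross p Z ?_ (f : V →ₗ[ℝ] ℝ) (f a) T (by rw [hV]; exact hT2) q y hq hy ?_ ?_
        · intro I J hIJ hc
          obtain ⟨g, t, h1, h2⟩ := hY3 (I, J) (Finset.mem_filter.2 ⟨Finset.mem_univ _, hIJ, by
            rw [hV] at hc; exact hc⟩)
          exact ⟨g, t, fun i hi x hx => h1 i hi x (hZ1 i hx), fun i hi x hx => h2 i hi x (hZ1 i hx)⟩
        · intro i _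
          exact (hf1 _ (subset_convexHull ℝ _ ⟨i, rfl⟩)).trans hf2
        · intro i hi
          exact (Finset.mem_filter.1 (hT1 hi)).2

open Classical in
theorem os_tree (d K : ℕ) (hK : K = (d + 1) ^ 2) : ∀ T : ℕ, ∃ c : ℝ, 0 < c ∧ c ≤ 1 ∧
    ∀ (X : Finset (Fin d → ℝ)) (s : ℕ), (s : ℝ) ≤ c * X.card →
    ∃ (Λ : Type) (_ : Fintype Λ) (Y : Λ → Finset (Fin d → ℝ)) (A : Multiset (Fin d → ℝ)),
      Fintype.card Λ = K ^ T ∧ (∀ l, Y l ⊆ X) ∧ (∀ l m, l ≠ m → Disjoint (Y l) (Y m)) ∧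
      (∀ l, (Y l).card = s) ∧ A.card = T * K ^ T ∧
      ∀ C : Set (Fin d → ℝ), Convex ℝ C → (∃ l, ∃ x ∈ Y l, x ∈ C) →
        (T + K) * (∑ l : Λ, if (∃ x ∈ Y l, x ∈ C) then 1 else 0) 
          ≤ A.countP (fun x => x ∈ C) + K * K ^ T := by
  intro T
  induction T with
  | zero =>
    refine ⟨1, one_pos, le_rfl, ?_⟩
    intro X s hs
    have hs' : s ≤ X.card := by rw [one_mul] at hs; exact_mod_cast hs
    obtain ⟨Z, hZ, hZs⟩ := Finset.exists_subset_card_eq hs'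
    refine ⟨Unit, inferInstance, fun _ => Z, 0, by simp, fun _ => hZ, ?_, fun _ => hZs, by simp, ?_⟩
    · intro l m h; exact (h (Subsingleton.elim _ _)).elim
    · intro C _ h
      obtain ⟨_, h⟩ := h
      simp [h]
  | succ T ih =>
    obtain ⟨c₁, hc₁, hc₁', ih⟩ := ih
    obtain ⟨c, hc, hnode⟩ := os_node (Fin d → ℝ) K d hK.ge
    have hK0 : 0 < K := by rw [hK]; positivity
    refine ⟨min 1 (c₁ * c / 2), by positivity, min_le_left _ _, ?_⟩
    intro X s hs
    have hs2 : (s : ℝ) ≤ c₁ * c / 2 * X.card :=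
      hs.trans (mul_le_mul_of_nonneg_right (min_le_right _ _) (by positivity))
    have hcX : 0 ≤ c * X.card := by positivity
    obtain ⟨s', hs'⟩ : ∃ s' : ℕ, s' = ⌊c * X.card⌋₊ := ⟨_, rfl⟩
    have hs'1 : (s' : ℝ) ≤ c * X.card := by rw [hs']; exact Nat.floor_le hcX
    have hs'2 : (s : ℝ) ≤ c₁ * s' := by
      rcases Nat.eq_zero_or_pos s with rfl | h
      · simp; positivity
      · have h1 : (1 : ℝ) ≤ s := by exact_mod_cast h
        have h2 : c * X.card < s' + 1 := by rw [hs']; exact Nat.lt_floor_add_one _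
        have h3 : (1 : ℝ) ≤ c₁ * (c * X.card / 2) := by linarith
        have h4 : (1 : ℝ) ≤ c * X.card / 2 := by
          have : c₁ * (c * X.card / 2) ≤ c * X.card / 2 := 
            mul_le_of_le_one_left (by positivity) hc₁'
          linarith
        have h5 : c * X.card / 2 ≤ s' := by linarith
        have := mul_le_mul_of_nonneg_left h5 hc₁.le
        linarith
    obtain ⟨Q, hQ1, hQ2, hQ3, a, ha⟩ := hnode (Fin d → ℝ) (by simp) id X s' hs'1
    choose Λ hΛ Y A hcard hYQ hdis hYs hA hmain using fun k => ih (Q k) s (by rw [hQ3]; exact hs'2)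
    refine ⟨Σ k, Λ k, inferInstance, fun l => Y l.1 l.2, 
      Multiset.replicate (K ^ (T + 1)) a + ∑ k, A k, ?_, ?_, ?_, ?_, ?_, ?_⟩
    · simp [Fintype.card_sigma, hcard]; ring
    · intro l; exact (hYQ l.1 l.2).trans (hQ1 l.1)
    · rintro ⟨k, l⟩ ⟨k', l'⟩ h
      by_cases hk : k = k'
      · subst hk
        exact hdis k l l' (fun h' => h (by rw [h']))
      · exact Finset.disjoint_of_subset_left (hYQ k l) 
          (Finset.disjoint_of_subset_right (hYQ k' l') (hQ2 k k' hk))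
    · intro l; exact hYs _ _
    · simp [Multiset.card_sum, hA]; ring
    · intro C hC _
      rw [Fintype.sum_sigma, Multiset.countP_add]
      have hsum : (∑ k, A k).countP (fun x => x ∈ C) = ∑ k, (A k).countP (fun x => x ∈ C) := by
        exact map_sum (Multiset.countPAddMonoidHom (fun x => x ∈ C)) A Finset.univ
      rw [hsum]
      set Lk : Fin K → ℕ := fun k => ∑ l : Λ k, if (∃ x ∈ Y k l, x ∈ C) then 1 else 0 with hLk
      set n : Fin K → ℕ := fun k => (A k).countP (fun x => x ∈ C) with hn
      let hit : Fin K → Prop := fun k => ∃ l, ∃ x ∈ Y k l, x ∈ C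
      have hLle : ∀ k, Lk k ≤ K ^ T := by
        intro k
        calc Lk k ≤ ∑ l : Λ k, 1 := Finset.sum_le_sum (fun l _ => by split_ifs <;> simp)
          _ = K ^ T := by simp [hcard]
      have hk : ∀ k, (T + K) * Lk k ≤ n k + K * K ^ T * (if hit k then 1 else 0) := by
        intro k
        by_cases h : hit k
        · simp only [h, if_true, mul_one]
          exact hmain k C hC h
        · have : Lk k = 0 := by
            apply Finset.sum_eq_zero
            intro l _
            rw [if_neg]
            exact fun h' => h ⟨l, h'⟩
          rw [this]; simp
      have hS := Finset.sum_le_sum (fun k (_ : k ∈ Finset.univ) => hk k)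
      rw [← Finset.mul_sum, Finset.sum_add_distrib, ← Finset.mul_sum] at hS
      have hLtot : ∑ k, Lk k ≤ K * K ^ T := by
        calc ∑ k, Lk k ≤ ∑ k : Fin K, K ^ T := Finset.sum_le_sum (fun k _ => hLle k)
          _ = K * K ^ T := by simp
      have hhit : ∑ k, (if hit k then 1 else 0) = (Finset.univ.filter hit).card := by
        rw [Finset.card_filter]
      rw [hhit] at hS
      have hgoal : (T + 1 + K) * ∑ k, Lk k ≤ 
          Multiset.countP (fun x => x ∈ C) (Multiset.replicate (K ^ (T + 1)) a) + ∑ k, n k 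
            + K * K ^ (T + 1) := by
        have hpow : K ^ (T + 1) = K * K ^ T := by ring
        by_cases hall : ∀ k, hit k
        · have haC : a ∈ C := by
            choose l q hqY hqC using hall
            have := ha q (fun k => hYQ k (l k) (hqY k))
            refine convexHull_min ?_ hC this
            rintro _ ⟨k, rfl⟩
            exact hqC k
          have e1 : Multiset.countP (fun x => x ∈ C) (Multiset.replicate (K ^ (T + 1)) a) 
              = K ^ (T + 1) := by
            rw [Multiset.countP_eq_card.2, Multiset.card_replicate]
            intro x hx
            rw [Multiset.eq_of_mem_replicate hx]; exact haC
          have e2 : (Finset.univ.filter hit).card ≤ K := by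
            simpa using Finset.card_le_univ (Finset.univ.filter hit)
          have e3 := Nat.mul_le_mul_left (K * K ^ T) e2
          rw [e1, hpow]
          nlinarith
        · have e2 : (Finset.univ.filter hit).card + 1 ≤ K := by
            push Not at hall
            obtain ⟨k0, hk0⟩ := hall
            have : (Finset.univ.filter hit).card < (Finset.univ : Finset (Fin K)).card := by
              apply Finset.card_lt_card
              rw [Finset.filter_ssubset]
              exact ⟨k0, Finset.mem_univ _, hk0⟩
            simpa using this
          have e3 := Nat.mul_le_mul_left (K * K ^ T) e2
          rw [hpow]
          nlinarith
      exact hgoal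

open Classical in
theorem os_greedy (d K T : ℕ) (c : ℝ)
    (htree : ∀ (X : Finset (Fin d → ℝ)) (s : ℕ), (s : ℝ) ≤ c * X.card →
    ∃ (Λ : Type) (_ : Fintype Λ) (Y : Λ → Finset (Fin d → ℝ)) (A : Multiset (Fin d → ℝ)),
      Fintype.card Λ = K ^ T ∧ (∀ l, Y l ⊆ X) ∧ (∀ l m, l ≠ m → Disjoint (Y l) (Y m)) ∧
      (∀ l, (Y l).card = s) ∧ A.card = T * K ^ T ∧
      ∀ C : Set (Fin d → ℝ), Convex ℝ C → (∃ l, ∃ x ∈ Y l, x ∈ C) →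
        (T + K) * (∑ l : Λ, if (∃ x ∈ Y l, x ∈ C) then 1 else 0) 
          ≤ A.countP (fun x => x ∈ C) + K * K ^ T)
    (hc : 0 < c) (hK : 0 < K) (s : ℕ) (hs : 0 < s) (r : ℝ) (hr : (s : ℝ) ≤ c * r) :
    ∀ (m : ℕ) (X : Finset (Fin d → ℝ)), X.card ≤ m → ∃ (B : ℕ) (A : Multiset (Fin d → ℝ)),
      A.card = B * (T * K ^ T) ∧ B * (K ^ T * s) ≤ X.card ∧
      ∀ C : Set (Fin d → ℝ), Convex ℝ C →
        (T : ℝ) * (X.filter (fun x => x ∈ C)).card ≤ T * r + 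
          s * (A.countP (fun x => x ∈ C) + B * (K * K ^ T)) := by
  have hr0 : 0 ≤ r := by
    by_contra h
    push Not at h
    have : c * r < 0 := mul_neg_of_pos_of_neg hc h
    have : (0:ℝ) ≤ s := by positivity
    linarith
  intro m
  induction m with
  | zero =>
    intro X hX
    have : X = ∅ := by simpa using hX
    subst this
    refine ⟨0, 0, by simp, by simp, fun C _ => ?_⟩
    simp; positivity
  | succ m ih =>
    intro X hX
    by_cases hXr : (X.card : ℝ) < r
    · refine ⟨0, 0, by simp, by simp, fun C _ => ?_⟩
      have h1 : ((X.filter (fun x => x ∈ C)).card : ℝ) ≤ r :=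
        le_trans (by exact_mod_cast Finset.card_filter_le _ _) hXr.le
      have := mul_le_mul_of_nonneg_left h1 (Nat.cast_nonneg (α := ℝ) T)
      simpa using this
    · push Not at hXr
      obtain ⟨Λ, _, Y, A, hΛ, hYX, hdis, hYs, hA, hmain⟩ := 
        htree X s (hr.trans (mul_le_mul_of_nonneg_left hXr hc.le))
      let U : Finset (Fin d → ℝ) := Finset.univ.biUnion Y
      have hUX : U ⊆ X := Finset.biUnion_subset.2 (fun l _ => hYX l)
      have hUc : U.card = K ^ T * s := by
        rw [Finset.card_biUnion (fun l _ m _ h => hdis l m h)]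
        simp [hYs, hΛ]
      have hUpos : 0 < K ^ T * s := by positivity
      have hXU : (X \ U).card + K ^ T * s = X.card := by
        rw [← hUc]; exact Finset.card_sdiff_add_card_eq_card hUX
      obtain ⟨B, A', hA', hB, hm'⟩ := ih (X \ U) (by omega)
      refine ⟨B + 1, A + A', ?_, ?_, ?_⟩
      · rw [Multiset.card_add, hA, hA']; ring
      · rw [add_mul, one_mul]; omega
      · intro C hC
        have h1 := hm' C hC
        have h2 : (X.filter (fun x => x ∈ C)).card ≤ ((X \ U).filter (fun x => x ∈ C)).card 
            + (U.filter (fun x => x ∈ C)).card := by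
          have e : X.filter (fun x => x ∈ C) =
              (X \ U).filter (fun x => x ∈ C) ∪ U.filter (fun x => x ∈ C) := by
            rw [← Finset.filter_union, Finset.sdiff_union_of_subset hUX]
          rw [e]
          exact Finset.card_union_le _ _
        have h3 : (U.filter (fun x => x ∈ C)).card 
            ≤ s * (∑ l : Λ, if (∃ x ∈ Y l, x ∈ C) then 1 else 0) := by
          rw [Finset.filter_biUnion, Finset.mul_sum]
          refine Finset.card_biUnion_le.trans (Finset.sum_le_sum ?_)
          intro l _
          split_ifs with h
          · rw [mul_one, ← hYs l]; exact Finset.card_filter_le _ _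
          · push Not at h
            rw [Finset.filter_false_of_mem h]; simp
        have h4 : T * (∑ l : Λ, if (∃ x ∈ Y l, x ∈ C) then 1 else 0) 
          ≤ A.countP (fun x => x ∈ C) + K * K ^ T := by
          by_cases hex : ∃ l, ∃ x ∈ Y l, x ∈ C
          · exact le_trans (Nat.mul_le_mul_right _ (Nat.le_add_right _ _)) (hmain C hC hex)
          · rw [Finset.sum_eq_zero]
            · simp
            · intro l _
              rw [if_neg]
              exact fun h' => hex ⟨l, h'⟩
        have h5 : T * (U.filter (fun x => x ∈ C)).card 
            ≤ s * (A.countP (fun x => x ∈ C) + K * K ^ T) := by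
          calc _ ≤ T * (s * (∑ l : Λ, if (∃ x ∈ Y l, x ∈ C) then 1 else 0)) := 
                Nat.mul_le_mul_left _ h3
            _ = s * (T * (∑ l : Λ, if (∃ x ∈ Y l, x ∈ C) then 1 else 0)) := by ring
            _ ≤ _ := Nat.mul_le_mul_left _ h4
        have h5' : (T : ℝ) * (U.filter (fun x => x ∈ C)).card 
            ≤ s * (A.countP (fun x => x ∈ C) + K * K ^ T) := by exact_mod_cast h5
        have h2' : ((X.filter (fun x => x ∈ C)).card : ℝ) ≤ ((X \ U).filter (fun x => x ∈ C)).card 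
            + (U.filter (fun x => x ∈ C)).card := by exact_mod_cast h2
        have h6 := mul_le_mul_of_nonneg_left h2' (Nat.cast_nonneg (α := ℝ) T)
        rw [Multiset.countP_add]
        push_cast
        linarith

open Classical in
theorem os_multiset {d : ℕ} (A : Multiset (Fin d → ℝ)) :
    ∃ a : Fin A.card → (Fin d → ℝ), ∀ C : Set (Fin d → ℝ),
      {i | a i ∈ C}.ncard = A.countP (fun x => x ∈ C) := by
  obtain ⟨l, rfl⟩ : ∃ l : List (Fin d → ℝ), A = (l : Multiset (Fin d → ℝ)) :=
    ⟨A.toList, (Multiset.coe_toList A).symm⟩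
  refine ⟨l.get, fun C => ?_⟩
  have h : (l : Multiset (Fin d → ℝ)) = Multiset.map l.get Finset.univ.val := by
    simp
  have h1 : Multiset.countP (fun x => x ∈ C) (l : Multiset (Fin d → ℝ)) =
      (Finset.univ.filter fun i => l.get i ∈ C).card := by
    conv_lhs => rw [h]
    rw [Multiset.countP_map]
    rfl
  rw [h1, ← Set.ncard_coe_finset]
  congr 1
  ext i
  simp

theorem stmt17 :
    ∃ g : ℝ → ℕ → ℕ, ∀ (d : ℕ) (P : Finset (Fin d → ℝ)), P.Nonempty →
      ∀ ε : ℝ, 0 < ε → ε ≤ 1 →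
        ∃ (N : ℕ) (a : Fin N → (Fin d → ℝ)), 0 < N ∧ N ≤ g ε d ∧
          ∀ C : Set (Fin d → ℝ), Convex ℝ C →
            (((↑P : Set (Fin d → ℝ)) ∩ C).ncard : ℝ) / P.card
              - ({i : Fin N | a i ∈ C}.ncard : ℝ) / N ≤ ε := by
  classical
  suffices H : ∀ (ε : ℝ) (d : ℕ), ∃ n : ℕ, 0 < ε → ε ≤ 1 → ∀ P : Finset (Fin d → ℝ), P.Nonempty →
      ∃ A : Multiset (Fin d → ℝ), 0 < A.card ∧ A.card ≤ n ∧ ∀ C : Set (Fin d → ℝ), Convex ℝ C →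
        ((P.filter (fun x => x ∈ C)).card : ℝ) / P.card 
          - (A.countP (fun x => x ∈ C) : ℝ) / A.card ≤ ε by
    choose g hg using H
    refine ⟨g, fun d P hP ε h0 h1 => ?_⟩
    obtain ⟨A, hA0, hAn, hA⟩ := hg ε d h0 h1 P hP
    obtain ⟨a, ha⟩ := os_multiset A
    refine ⟨A.card, a, hA0, hAn, fun C hC => ?_⟩
    rw [ha C]
    have e : ((↑P : Set (Fin d → ℝ)) ∩ C).ncard = (P.filter (fun x => x ∈ C)).card := by
      rw [← Set.ncard_coe_finset]
      congr 1
      ext x; simp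
    rw [e]
    exact hA C hC
  intro ε d
  by_cases hε : 0 < ε
  swap
  · exact ⟨0, fun h => (hε h).elim⟩
  obtain ⟨K, hK⟩ : ∃ K, K = (d + 1) ^ 2 := ⟨_, rfl⟩
  have hK0 : 0 < K := by rw [hK]; positivity
  obtain ⟨T, hT⟩ := exists_nat_gt ((K : ℝ) / (ε / 2))
  have hT0 : (0 : ℝ) < T := lt_of_le_of_lt (by positivity) hT
  have hKT : (K : ℝ) ≤ ε / 2 * T := by
    rw [div_lt_iff₀ (by positivity)] at hT; linarith
  obtain ⟨c, hc, hc1, htree⟩ := os_tree d K hK T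
  refine ⟨⌈2 / (c * ε)⌉₊ + ⌈4 / (c * ε)⌉₊ * (T * K ^ T), fun _ hε1 P hP => ?_⟩
  have hP0 : (0 : ℝ) < P.card := by exact_mod_cast hP.card_pos
  obtain ⟨r, hrd⟩ : ∃ r : ℝ, r = ε / 2 * P.card := ⟨_, rfl⟩
  have hr0 : 0 < r := by rw [hrd]; positivity
  obtain ⟨s, hsd⟩ : ∃ s : ℕ, s = ⌊c * r⌋₊ := ⟨_, rfl⟩
  have hs1 : (s : ℝ) ≤ c * r := by rw [hsd]; exact Nat.floor_le (by positivity)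
  have hs2 : c * r < s + 1 := by rw [hsd]; exact Nat.lt_floor_add_one _
  rcases Nat.eq_zero_or_pos s with h0 | hspos
  · refine ⟨P.val, hP.card_pos, ?_, ?_⟩
    · have : (P.card : ℝ) ≤ 2 / (c * ε) := by
        rw [h0, hrd] at hs2
        rw [le_div_iff₀ (by positivity)]
        push_cast at hs2
        nlinarith
      have h3 : P.card ≤ ⌈2 / (c * ε)⌉₊ := by
        have := this.trans (Nat.le_ceil _)
        exact_mod_cast this
      exact h3.trans (Nat.le_add_right _ _)
    · intro C _
      rw [Multiset.countP_eq_card_filter]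
      change ((P.filter (fun x => x ∈ C)).card : ℝ) / P.card 
        - ((P.filter (fun x => x ∈ C)).card : ℝ) / P.card ≤ ε
      linarith
  · obtain ⟨B, A, hA, hB, hmain⟩ := os_greedy d K T c htree hc hK0 s hspos r hs1 P.card P le_rfl
    have hs1' : (1 : ℝ) ≤ s := by exact_mod_cast hspos
    have hsP : c * ε * P.card ≤ 4 * s := by
      rw [hrd] at hs2
      nlinarith
    have hBR : (B : ℝ) * (K ^ T * s) ≤ P.card := by exact_mod_cast hB
    have hB0 : 0 < B := by
      rcases Nat.eq_zero_or_pos B with h | h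
      · exfalso
        subst h
        have hA0 : A = 0 := by rw [← Multiset.card_eq_zero, hA]; simp
        have := hmain Set.univ convex_univ
        simp [hA0] at this
        have h2 := le_of_mul_le_mul_left this hT0
        rw [hrd] at h2
        nlinarith
      · exact h
    have hTn : 0 < T := by exact_mod_cast hT0
    refine ⟨A, by rw [hA]; positivity, ?_, ?_⟩
    · rw [hA]
      have hBle : B ≤ ⌈4 / (c * ε)⌉₊ := by
        have h1 : (B : ℝ) * s ≤ P.card := by
          have hK1 : (1 : ℝ) ≤ (K : ℝ) ^ T := one_le_pow₀ (by exact_mod_cast hK0)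
          have : (B : ℝ) * s ≤ B * (K ^ T * s) := by
            apply mul_le_mul_of_nonneg_left _ (by positivity)
            exact le_mul_of_one_le_left (by positivity) hK1
          linarith
        have h2 : (B : ℝ) ≤ 4 / (c * ε) := by
          rw [le_div_iff₀ (by positivity)]
          have h3 : c * ε * (B * s) ≤ 4 * s := le_trans (mul_le_mul_of_nonneg_left h1 (by positivity)) hsP
          have h4 : (B * (c * ε)) * s ≤ 4 * s := by linarith
          exact le_of_mul_le_mul_right h4 (by linarith)
        have := h2.trans (Nat.le_ceil _)
        exact_mod_cast this
      exact (Nat.mul_le_mul_right _ hBle).trans (Nat.le_add_left _ _)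
    · intro C hC
      have h := hmain C hC
      obtain ⟨n, hn⟩ : ∃ n : ℝ, n = (A.countP (fun x => x ∈ C) : ℝ) := ⟨_, rfl⟩
      obtain ⟨u, hu⟩ : ∃ u : ℝ, u = ((P.filter (fun x => x ∈ C)).card : ℝ) := ⟨_, rfl⟩
      have hn0 : 0 ≤ n := by rw [hn]; positivity
      rw [← hn, ← hu] at h
      rw [← hn, ← hu, hA]
      push_cast
      have hBp : (0 : ℝ) < B := by exact_mod_cast hB0
      have hKp : (0 : ℝ) < (K : ℝ) ^ T := by positivity
      obtain ⟨M, hM⟩ : ∃ M : ℝ, M = (B : ℝ) * K ^ T := ⟨_, rfl⟩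
      have hMp : 0 < M := by rw [hM]; positivity
      have hMs : M * s ≤ P.card := by rw [hM]; linarith
      have e1 : (B : ℝ) * (T * K ^ T) = T * M := by rw [hM]; ring
      have e2 : (B : ℝ) * (K * K ^ T) = K * M := by rw [hM]; ring
      rw [e1]
      rw [e2] at h
      -- divide by T * P.card
      have g1 : s * n ≤ P.card * (n / M) := by
        have : s * n = (M * s) * (n / M) := by field_simp
        rw [this]
        exact mul_le_mul_of_nonneg_right hMs (by positivity)
      have g2 : s * (K * M) ≤ ε / 2 * T * P.card := by
        calc s * (K * M) = K * (M * s) := by ring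
          _ ≤ K * P.card := mul_le_mul_of_nonneg_left hMs (by positivity)
          _ ≤ _ := mul_le_mul_of_nonneg_right hKT hP0.le
      have g3 : T * u ≤ T * (P.card * (ε + n / (T * M))) := by
        have : T * (P.card * (ε + n / (T * M))) = T * P.card * ε + P.card * (n / M) := by field_simp
        rw [this]
        rw [hrd] at h
        linarith
      have g4 := le_of_mul_le_mul_left g3 hT0
      have g5 : u / P.card ≤ ε + n / (T * M) := by
        rw [div_le_iff₀ hP0]; linarith
      linarith
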